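/- arXiv:2310.19101 — 2 statements merged into one kernel-verified Lean document; each statement's English description precedes it below -/
import Mathlib

section
/- Let d ≥ 3, let V : ℝ^d → ℝ be continuous, and fix r > 0 and R > 0. Suppose there is a function λ : ℝ^d → ℝ with λ(y) → +∞ as |y| → ∞ such that for every y ∈ ℝ^d with |y| ≥ R there exists a twice continuously differentiable function v on the open ball B_r(y) satisfying the Riccati equation −Δv(x) + |∇v(x)|² + λ(y) = V(x) for all x ∈ B_r(y). Then the family 𝒲_y(t) = ∫_{B_t(y)} V(x) dx tends to +∞ in Lebesgue measure on (0,r) as |y| → ∞; that is, for every A > 0 and every ε > 0 there exists R' > 0 such that for all y with |y| ≥ R', mes₁({t ∈ (0,r) : 𝒲_y(t) ≤ A}) ≤ ε. -/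
open MeasureTheory Metric Filter

/-- The Laplacian of a function on `ℝ^d`, as the sum of second partial derivatives. -/
noncomputable def laplacian {d : ℕ} (v : EuclideanSpace ℝ (Fin d) → ℝ)
    (x : EuclideanSpace ℝ (Fin d)) : ℝ :=
  ∑ i : Fin d, fderiv ℝ (fderiv ℝ v) x (EuclideanSpace.single i 1) (EuclideanSpace.single i 1)

theorem st_deriv_bound : ∃ C : ℝ, 0 < C ∧ ∀ u, |deriv Real.smoothTransition u| ≤ C := by
  have hc : Continuous (deriv Real.smoothTransition) :=
    (Real.smoothTransition.contDiff (n := 1)).continuous_deriv (by norm_num)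
  obtain ⟨C, hC⟩ := (isCompact_Icc (a := (0:ℝ)) (b := 1)).exists_bound_of_continuousOn hc.continuousOn
  refine ⟨max C 1, by positivity, fun u => ?_⟩
  by_cases h : u ∈ Set.Icc (0:ℝ) 1
  · exact (hC u h).trans (le_max_left _ _)
  · have : deriv Real.smoothTransition u = 0 := by
      by_cases h0 : u < 0
      · have : IsLocalMin Real.smoothTransition u := by
          refine Filter.Eventually.of_forall fun z => ?_
          rw [Real.smoothTransition.zero_of_nonpos h0.le]
          exact Real.smoothTransition.nonneg z
        exact this.deriv_eq_zero
      · have : IsLocalMax Real.smoothTransition u := by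
          refine Filter.Eventually.of_forall fun z => ?_
          rw [Real.smoothTransition.one_of_one_le (x := u)]
          · exact Real.smoothTransition.le_one z
          · by_contra h1
            exact h ⟨by linarith, by linarith⟩
        exact this.deriv_eq_zero
    rw [this]; simp

theorem st_deriv_zero {u : ℝ} (h : u ≤ 0 ∨ 1 ≤ u) : deriv Real.smoothTransition u = 0 := by
  rcases h with h | h
  · have : IsLocalMin Real.smoothTransition u := by
      refine Filter.Eventually.of_forall fun z => ?_
      rw [Real.smoothTransition.zero_of_nonpos h]
      exact Real.smoothTransition.nonneg z
    exact this.deriv_eq_zero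
  · have : IsLocalMax Real.smoothTransition u := by
      refine Filter.Eventually.of_forall fun z => ?_
      rw [Real.smoothTransition.one_of_one_le h]
      exact Real.smoothTransition.le_one z
    exact this.deriv_eq_zero

/-- one-dimensional measure estimate -/
theorem oneD {G : ℝ → ℝ} {a b K κ : ℝ} (hab : a ≤ b) (hK : 0 < K) (hκ : 0 < κ)
    (hG : MonotoneOn G (Set.Icc a b)) (hG0 : ∀ t ∈ Set.Icc a b, 0 ≤ G t) (S : Set ℝ)
    (hS : ∀ t ∈ S, t ∈ Set.Ioo a b ∧ (DifferentiableAt ℝ G t → (G t + K) ^ 2 ≤ κ * deriv G t)) :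
    volume S ≤ ENNReal.ofReal (κ / K) := by
  set U : ℝ → ℝ := fun t => -(G t + K)⁻¹ with hU
  have hpos : ∀ t ∈ Set.Icc a b, 0 < G t + K := fun t ht => by linarith [hG0 t ht]
  have hUm : MonotoneOn U (Set.Icc a b) := by
    intro s hs t ht hst
    simp only [hU]
    have := inv_anti₀ (hpos s hs) (add_le_add_left (hG hs ht hst) K)
    linarith
  have hUm' : MonotoneOn U (Set.uIcc a b) := by rwa [Set.uIcc_of_le hab]
  have hint := hUm'.intervalIntegrable_deriv
  have hle := hUm'.intervalIntegral_deriv_mem_uIcc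
  have hUab : U a ≤ U b := hUm (Set.left_mem_Icc.2 hab) (Set.right_mem_Icc.2 hab) hab
  rw [Set.uIcc_of_le (by linarith)] at hle
  have hUle : U b - U a ≤ 1 / K := by
    have h1 : 0 < (G b + K)⁻¹ := inv_pos.2 (hpos b (Set.right_mem_Icc.2 hab))
    have h2 : (G a + K)⁻¹ ≤ K⁻¹ := inv_anti₀ hK (by linarith [hG0 a (Set.left_mem_Icc.2 hab)])
    simp only [hU]; rw [one_div]; linarith
  have hd : ∀ᵐ t, t ∈ Set.Icc a b → DifferentiableWithinAt ℝ G (Set.Icc a b) t :=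
    hG.ae_differentiableWithinAt_of_mem
  have hderivnn : ∀ t ∈ Set.Ioo a b, 0 ≤ deriv U t := by
    intro t ht
    rw [← derivWithin_of_mem_nhds (Icc_mem_nhds ht.1 ht.2)]
    exact hUm.derivWithin_nonneg
  have hsub : ∀ᵐ t, t ∈ S → t ∈ {t | ENNReal.ofReal κ⁻¹ ≤ ENNReal.ofReal (deriv U t)} ∩ Set.Ioo a b := by
    filter_upwards [hd] with t ht htS
    obtain ⟨hab', h2⟩ := hS t htS
    refine ⟨?_, hab'⟩
    have hdt : DifferentiableAt ℝ G t :=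
      (ht (Set.Ioo_subset_Icc_self hab')).differentiableAt (Icc_mem_nhds hab'.1 hab'.2)
    have h3 := h2 hdt
    have hp := hpos t (Set.Ioo_subset_Icc_self hab')
    have hder : HasDerivAt U (deriv G t / (G t + K) ^ 2) t := by
      have := ((hdt.hasDerivAt.add_const K).fun_inv hp.ne').fun_neg
      have e : deriv G t / (G t + K) ^ 2 = -(-deriv G t / (G t + K) ^ 2) := by rw [neg_div, neg_neg]
      rw [e]; exact this
    apply ENNReal.ofReal_le_ofReal
    rw [hder.deriv, le_div_iff₀ (by positivity), inv_mul_le_iff₀ hκ]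
    exact h3
  have hmeas : Measurable fun t => ENNReal.ofReal (deriv U t) :=
    (measurable_deriv U).ennreal_ofReal
  have hM := mul_meas_ge_le_lintegral (μ := volume.restrict (Set.Ioo a b)) hmeas (ENNReal.ofReal κ⁻¹)
  rw [Measure.restrict_apply (measurableSet_le measurable_const hmeas)] at hM
  rw [intervalIntegral.integral_of_le hab, integral_Ioc_eq_integral_Ioo] at hle
  rw [intervalIntegrable_iff_integrableOn_Ioo_of_le hab] at hint
  rw [← ofReal_integral_eq_lintegral_ofReal hint
    ((ae_restrict_iff' measurableSet_Ioo).2 (Filter.Eventually.of_forall hderivnn))] at hM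
  have h5 : volume S ≤ volume ({t | ENNReal.ofReal κ⁻¹ ≤ ENNReal.ofReal (deriv U t)} ∩ Set.Ioo a b) :=
    measure_mono_ae hsub
  have h6 : ENNReal.ofReal κ⁻¹ * volume S ≤ ENNReal.ofReal (1 / K) :=
    (mul_le_mul_right h5 _).trans (hM.trans (ENNReal.ofReal_le_ofReal (hle.2.trans hUle)))
  have h7 : volume S = ENNReal.ofReal κ * (ENNReal.ofReal κ⁻¹ * volume S) := by
    rw [← mul_assoc, ← ENNReal.ofReal_mul hκ.le, mul_inv_cancel₀ hκ.ne']; simp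
  rw [h7]
  calc _ ≤ ENNReal.ofReal κ * ENNReal.ofReal (1 / K) := mul_le_mul_right h6 _
    _ = _ := by rw [← ENNReal.ofReal_mul hκ.le]; congr 1; ring

theorem cutoff_ineq {d : ℕ} {C : ℝ} (hC : 0 < C)
    (hCb : ∀ u, |deriv Real.smoothTransition u| ≤ C)
    (y : EuclideanSpace ℝ (Fin d)) {r a b : ℝ} (ha : 0 < a) (hab : a < b) (hbr : b < r)
    (v : EuclideanSpace ℝ (Fin d) → ℝ) (hv : ContDiffOn ℝ 2 v (ball y r)) :
    |∫ x, Real.smoothTransition ((b ^ 2 - ‖x - y‖ ^ 2) / (b ^ 2 - a ^ 2)) * laplacian v x|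
      ≤ ∫ x in ball y b \ ball y a, 2 * C / (b - a) * ‖fderiv ℝ v x‖ := by
  have hb2 : 0 < b ^ 2 - a ^ 2 := by nlinarith
  set φ : EuclideanSpace ℝ (Fin d) → ℝ :=
    fun x => Real.smoothTransition ((b ^ 2 - ‖x - y‖ ^ 2) / (b ^ 2 - a ^ 2)) with hφ
  have hφz : ∀ x, x ∉ ball y b → φ x = 0 := by
    intro x hx
    apply Real.smoothTransition.zero_of_nonpos
    rw [mem_ball, dist_eq_norm, not_lt] at hx
    apply div_nonpos_of_nonpos_of_nonneg _ hb2.le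
    nlinarith
  have hts : tsupport φ ⊆ closedBall y b := by
    apply closure_minimal _ isClosed_closedBall
    intro x hx
    by_contra h
    exact hx (hφz x fun h' => h (ball_subset_closedBall h'))
  have hcb : closedBall y b ⊆ ball y r := closedBall_subset_ball hbr
  have hφd : ContDiff ℝ 1 φ := by
    apply (Real.smoothTransition.contDiff (n := 1)).comp
    apply ContDiff.div_const
    apply ContDiff.sub contDiff_const
    exact (contDiff_id.sub contDiff_const).norm_sq ℝ
  have hφ' : ∀ x e, fderiv ℝ φ x e = deriv Real.smoothTransition
      ((b ^ 2 - ‖x - y‖ ^ 2) / (b ^ 2 - a ^ 2)) * (-(2 * inner ℝ (x - y) e) / (b ^ 2 - a ^ 2)) := by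
    intro x e
    have h1 : HasFDerivAt (fun x : EuclideanSpace ℝ (Fin d) => ‖x - y‖ ^ 2)
        (2 • (innerSL ℝ (x - y))) x := by
      have := ((hasFDerivAt_id x).sub_const y).norm_sq
      simpa using this
    have h2 := ((h1.const_sub (b ^ 2)).mul_const (b ^ 2 - a ^ 2)⁻¹)
    have h3 : HasDerivAt Real.smoothTransition (deriv Real.smoothTransition
      ((b ^ 2 - ‖x - y‖ ^ 2) * (b ^ 2 - a ^ 2)⁻¹)) ((b ^ 2 - ‖x - y‖ ^ 2) * (b ^ 2 - a ^ 2)⁻¹) :=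
      ((Real.smoothTransition.contDiff (n := 1)).differentiable (by norm_num) _).hasDerivAt
    have h4 := h3.comp_hasFDerivAt x h2
    have h5 : φ = Real.smoothTransition ∘ fun x => (b ^ 2 - ‖x - y‖ ^ 2) * (b ^ 2 - a ^ 2)⁻¹ := by
      ext x; simp [hφ, div_eq_mul_inv]
    rw [h5, h4.fderiv]
    simp [div_eq_mul_inv, inner_sub_left]
    left
    ring
  have hv1 : ContDiffOn ℝ 1 (fderiv ℝ v) (ball y r) :=
    hv.fderiv_of_isOpen isOpen_ball (by norm_num)
  have hv2 : ContDiffOn ℝ 0 (fderiv ℝ (fderiv ℝ v)) (ball y r) :=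
    hv1.fderiv_of_isOpen isOpen_ball (by norm_num)
  have hvd : ∀ x ∈ ball y r, DifferentiableAt ℝ (fderiv ℝ v) x := fun x hx =>
    (hv1.differentiableOn (by norm_num)).differentiableAt (isOpen_ball.mem_nhds hx)
  have hfd : ∀ x ∈ ball y r, ∀ e, fderiv ℝ (fun z => fderiv ℝ v z e) x e
      = fderiv ℝ (fderiv ℝ v) x e e := by
    intro x hx e
    have := (hvd x hx).hasFDerivAt.clm_apply (hasFDerivAt_const e x)
    rw [this.fderiv]; simp
  have hφ'z : ∀ x, x ∉ ball y b \ ball y a → ∀ e, fderiv ℝ φ x e = 0 := by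
    intro x hx e
    rw [hφ', st_deriv_zero, zero_mul]
    by_cases h : x ∈ ball y b
    · right
      have : x ∈ ball y a := by by_contra h'; exact hx ⟨h, h'⟩
      rw [mem_ball, dist_eq_norm] at this
      rw [le_div_iff₀ hb2]
      nlinarith [norm_nonneg (x - y)]
    · left
      rw [mem_ball, dist_eq_norm, not_lt] at h
      apply div_nonpos_of_nonpos_of_nonneg _ hb2.le
      nlinarith
  -- integrability of functions continuous on the closed ball and vanishing outside
  have hintg : ∀ f : EuclideanSpace ℝ (Fin d) → ℝ, ContinuousOn f (closedBall y b) →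
      (∀ x, x ∉ closedBall y b → f x = 0) → Integrable f := by
    intro f hf hz
    have h1 : IntegrableOn f (closedBall y b) := hf.integrableOn_compact (isCompact_closedBall _ _)
    exact h1.integrable_of_forall_notMem_eq_zero hz
  have hc1 : ContinuousOn (fderiv ℝ v) (closedBall y b) := hv1.continuousOn.mono hcb
  have hc2 : ContinuousOn (fderiv ℝ (fderiv ℝ v)) (closedBall y b) := hv2.continuousOn.mono hcb
  have hcφ' : Continuous (fderiv ℝ φ) := hφd.continuous_fderiv (by norm_num)
  have hi1 : ∀ e : EuclideanSpace ℝ (Fin d),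
      Integrable fun x => fderiv ℝ φ x e * fderiv ℝ v x e := by
    intro e
    apply hintg
    · exact (hcφ'.clm_apply continuous_const).continuousOn.mul (hc1.clm_apply continuousOn_const)
    · intro x hx
      rw [hφ'z x (fun h => hx (ball_subset_closedBall h.1)), zero_mul]
  have hi2 : ∀ e : EuclideanSpace ℝ (Fin d),
      Integrable fun x => φ x * fderiv ℝ (fderiv ℝ v) x e e := by
    intro e
    apply hintg
    · exact hφd.continuous.continuousOn.mul
        ((hc2.clm_apply continuousOn_const).clm_apply continuousOn_const)
    · intro x hx
      rw [hφz x (fun h => hx (ball_subset_closedBall h)), zero_mul]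
  have hsame : ∀ e : EuclideanSpace ℝ (Fin d), (fun x => φ x * fderiv ℝ (fun z => fderiv ℝ v z e) x e)
      = fun x => φ x * fderiv ℝ (fderiv ℝ v) x e e := by
    intro e
    ext x
    by_cases hx : x ∈ ball y b
    · rw [hfd x (hcb (ball_subset_closedBall hx))]
    · rw [hφz x hx]; simp
  have hibp : ∀ e : EuclideanSpace ℝ (Fin d), ∫ x, φ x * fderiv ℝ (fderiv ℝ v) x e e
      = - ∫ x, fderiv ℝ φ x e * fderiv ℝ v x e := by
    intro e
    rw [← hsame]
    apply integral_mul_fderiv_eq_neg_fderiv_mul_of_integrable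
    · exact hi1 e
    · rw [hsame]; exact hi2 e
    · apply hintg
      · exact hφd.continuous.continuousOn.mul (hc1.clm_apply continuousOn_const)
      · intro x hx
        rw [hφz x (fun h => hx (ball_subset_closedBall h)), zero_mul]
    · intro x _
      exact hφd.differentiable (by norm_num) x
    · intro x hx
      exact (hvd x (hcb (hts hx))).clm_apply (differentiableAt_const e)
  have hmain : ∫ x, φ x * laplacian v x = - ∫ x, ∑ i : Fin d,
      fderiv ℝ φ x (EuclideanSpace.single i 1) * fderiv ℝ v x (EuclideanSpace.single i 1) := by
    simp only [laplacian, Finset.mul_sum]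
    rw [integral_finsetSum _ fun i _ => hi2 _, integral_finsetSum _ fun i _ => hi1 _,
      ← Finset.sum_neg_distrib]
    exact Finset.sum_congr rfl fun i _ => hibp _
  have hsum : ∀ x, ∑ i : Fin d,
      fderiv ℝ φ x (EuclideanSpace.single i 1) * fderiv ℝ v x (EuclideanSpace.single i 1)
      = deriv Real.smoothTransition ((b ^ 2 - ‖x - y‖ ^ 2) / (b ^ 2 - a ^ 2)) *
        (-2 / (b ^ 2 - a ^ 2)) * fderiv ℝ v x (x - y) := by
    intro x
    have h1 : x - y = ∑ i : Fin d, (x - y) i • EuclideanSpace.single i (1:ℝ) := by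
      ext j; simp [Finset.sum_apply, Pi.single_apply]
    conv_rhs => rw [h1, map_sum, Finset.mul_sum]
    rw [← h1]
    apply Finset.sum_congr rfl
    intro i _
    rw [hφ', map_smul, EuclideanSpace.inner_single_right]
    simp
    ring
  have hzero : ∀ x, x ∉ ball y b \ ball y a → ∑ i : Fin d,
      fderiv ℝ φ x (EuclideanSpace.single i 1) * fderiv ℝ v x (EuclideanSpace.single i 1) = 0 := by
    intro x hx
    simp [hφ'z x hx]
  change |∫ x, φ x * laplacian v x| ≤ _
  rw [hmain, abs_neg, ← setIntegral_eq_integral_of_forall_compl_eq_zero hzero, ← Real.norm_eq_abs]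
  refine norm_integral_le_of_norm_le ?_ ?_
  · exact ((hc1.norm.const_smul (2 * C / (b - a))).integrableOn_compact
      (isCompact_closedBall _ _)).mono_set (Set.sdiff_subset.trans ball_subset_closedBall)
  · rw [ae_restrict_iff' (measurableSet_ball.diff measurableSet_ball)]
    refine Eventually.of_forall fun x hx => ?_
    rw [hsum, norm_mul, norm_mul]
    have hxb : ‖x - y‖ ≤ b := by have := hx.1; rw [mem_ball, dist_eq_norm] at this; exact this.le
    have e1 : ‖fderiv ℝ v x (x - y)‖ ≤ ‖fderiv ℝ v x‖ * b :=
      (ContinuousLinearMap.le_opNorm _ _).trans (by gcongr)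
    have e2 : ‖-2 / (b ^ 2 - a ^ 2)‖ = 2 / (b ^ 2 - a ^ 2) := by
      rw [norm_div, Real.norm_eq_abs, Real.norm_eq_abs, abs_of_pos hb2]; norm_num
    have e3 : 2 / (b ^ 2 - a ^ 2) * b ≤ 2 / (b - a) := by
      rw [div_mul_eq_mul_div, div_le_div_iff₀ hb2 (by linarith)]
      nlinarith [mul_pos ha (sub_pos.2 hab)]
    rw [e2]
    calc _ ≤ C * (2 / (b ^ 2 - a ^ 2)) * (‖fderiv ℝ v x‖ * b) := by
          gcongr
          exact hCb _
      _ = C * (2 / (b ^ 2 - a ^ 2) * b) * ‖fderiv ℝ v x‖ := by ring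
      _ ≤ C * (2 / (b - a)) * ‖fderiv ℝ v x‖ := by gcongr
      _ = _ := by ring

theorem lap_cont {d : ℕ} {y : EuclideanSpace ℝ (Fin d)} {r : ℝ}
    {v : EuclideanSpace ℝ (Fin d) → ℝ} (hv : ContDiffOn ℝ 2 v (ball y r)) :
    ContinuousOn (laplacian v) (ball y r) := by
  have hv1 : ContDiffOn ℝ 1 (fderiv ℝ v) (ball y r) :=
    hv.fderiv_of_isOpen isOpen_ball (by norm_num)
  have hv2 : ContDiffOn ℝ 0 (fderiv ℝ (fderiv ℝ v)) (ball y r) :=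
    hv1.fderiv_of_isOpen isOpen_ball (by norm_num)
  unfold laplacian
  exact continuousOn_finsetSum _ fun i _ =>
    (hv2.continuousOn.clm_apply continuousOn_const).clm_apply continuousOn_const

theorem ann_vol {d : ℕ} (y : EuclideanSpace ℝ (Fin d)) {r t h : ℝ} (ht : 0 < t) (hh : 0 < h)
    (hr : t + h < r) :
    volume.real (ball y (t + h) \ ball y t) ≤
      volume.real (ball (0 : EuclideanSpace ℝ (Fin d)) 1) * d * r ^ (d - 1) * h := by
  have hb : ∀ s : ℝ, 0 < s → volume.real (ball y s) =
      s ^ d * volume.real (ball (0 : EuclideanSpace ℝ (Fin d)) 1) := by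
    intro s hs
    rw [measureReal_def, Measure.addHaar_ball_of_pos _ _ hs]
    simp [measureReal_def, hs.le]
  rw [measureReal_sdiff (ball_subset_ball (by linarith)) measurableSet_ball (by finiteness), hb _ ht, hb _ (by linarith), ← sub_mul]
  have h1 := abs_pow_sub_pow_le (t + h) t d
  rw [abs_of_pos (by linarith : 0 < t + h), abs_of_pos ht, max_eq_left (by linarith),
    add_sub_cancel_left, abs_of_pos hh] at h1
  have h2 : (t + h) ^ (d - 1) ≤ r ^ (d - 1) := by gcongr
  have h3 := (le_abs_self _).trans h1
  have h4 : 0 ≤ volume.real (ball (0 : EuclideanSpace ℝ (Fin d)) 1) := measureReal_nonneg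
  calc _ ≤ (h * d * r ^ (d - 1)) * volume.real (ball (0 : EuclideanSpace ℝ (Fin d)) 1) := by
        gcongr
        exact h3.trans (by gcongr)
    _ = _ := by ring

theorem bulk {d : ℕ} {C : ℝ} (hC : 0 < C)
    (hCb : ∀ u, |deriv Real.smoothTransition u| ≤ C)
    (y : EuclideanSpace ℝ (Fin d)) {r t h c M μ : ℝ} (ht : 0 < t) (hh : 0 < h) (hbr : t + h < r)
    (v : EuclideanSpace ℝ (Fin d) → ℝ) (hv : ContDiffOn ℝ 2 v (ball y r))
    (hc : c = volume.real (ball (0 : EuclideanSpace ℝ (Fin d)) 1) * d * r ^ (d - 1))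
    (hM0 : 0 ≤ M) (hM : ∀ x ∈ ball y (t + h), |laplacian v x| ≤ M) (hμ : 0 < μ) :
    ∫ x in ball y t, laplacian v x ≤ C * μ * c +
      C / μ * (h⁻¹ * ((∫ x in ball y (t + h), ‖fderiv ℝ v x‖ ^ 2)
        - ∫ x in ball y t, ‖fderiv ℝ v x‖ ^ 2)) + M * c * h := by
  have hcut := cutoff_ineq hC hCb y ht (by linarith : t < t + h) hbr v hv
  have hb2 : 0 < (t + h) ^ 2 - t ^ 2 := by nlinarith
  set φ : EuclideanSpace ℝ (Fin d) → ℝ :=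
    fun x => Real.smoothTransition (((t + h) ^ 2 - ‖x - y‖ ^ 2) / ((t + h) ^ 2 - t ^ 2)) with hφ
  have hφz : ∀ x, x ∉ ball y (t + h) → φ x = 0 := by
    intro x hx
    apply Real.smoothTransition.zero_of_nonpos
    rw [mem_ball, dist_eq_norm, not_lt] at hx
    apply div_nonpos_of_nonpos_of_nonneg _ hb2.le
    nlinarith
  have hφo : ∀ x, x ∈ ball y t → φ x = 1 := by
    intro x hx
    apply Real.smoothTransition.one_of_one_le
    rw [mem_ball, dist_eq_norm] at hx
    rw [le_div_iff₀ hb2]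
    nlinarith [norm_nonneg (x - y)]
  have hφc : Continuous φ := by
    apply Real.smoothTransition.continuous.comp
    fun_prop
  have hcb : closedBall y (t + h) ⊆ ball y r := closedBall_subset_ball hbr
  have hLc : ContinuousOn (laplacian v) (closedBall y (t + h)) := (lap_cont hv).mono hcb
  have hDc : ContinuousOn (fderiv ℝ v) (closedBall y (t + h)) :=
    ((hv.fderiv_of_isOpen (m := 1) isOpen_ball (by norm_num)).continuousOn).mono hcb
  have hsub : ball y t ⊆ ball y (t + h) := ball_subset_ball (by linarith)
  have hann := ann_vol y ht hh hbr
  rw [← hc] at hann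
  have hi : ∀ f : EuclideanSpace ℝ (Fin d) → ℝ, ContinuousOn f (closedBall y (t + h)) →
      IntegrableOn f (ball y (t + h)) := fun f hf =>
    (hf.integrableOn_compact (isCompact_closedBall _ _)).mono_set ball_subset_closedBall
  have hsplit : ∀ f : EuclideanSpace ℝ (Fin d) → ℝ, ContinuousOn f (closedBall y (t + h)) →
      ∫ x in ball y (t + h) \ ball y t, f x =
        (∫ x in ball y (t + h), f x) - ∫ x in ball y t, f x := fun f hf =>
    setIntegral_sdiff measurableSet_ball (hi f hf) hsub
  have hφL : ContinuousOn (fun x => φ x * laplacian v x) (closedBall y (t + h)) :=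
    hφc.continuousOn.mul hLc
  have e1 : ∫ x, φ x * laplacian v x = (∫ x in ball y t, laplacian v x) +
      ∫ x in ball y (t + h) \ ball y t, φ x * laplacian v x := by
    rw [hsplit _ hφL, setIntegral_eq_integral_of_forall_compl_eq_zero (s := ball y (t + h))
      (fun x hx => by rw [hφz x hx, zero_mul])]
    have : ∫ x in ball y t, φ x * laplacian v x = ∫ x in ball y t, laplacian v x :=
      setIntegral_congr_fun measurableSet_ball fun x hx => by simp [hφo x hx]
    rw [this]; ring
  have hfin : volume (ball y (t + h) \ ball y t) < ⊤ :=
    (measure_mono Set.sdiff_subset).trans_lt measure_ball_lt_top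
  have e2 : ‖∫ x in ball y (t + h) \ ball y t, φ x * laplacian v x‖ ≤
      M * volume.real (ball y (t + h) \ ball y t) := by
    apply norm_setIntegral_le_of_norm_le_const hfin
    intro x hx
    rw [norm_mul, Real.norm_eq_abs, Real.norm_eq_abs, abs_of_nonneg (Real.smoothTransition.nonneg _)]
    calc _ ≤ 1 * M := mul_le_mul (Real.smoothTransition.le_one _) (hM x hx.1) (abs_nonneg _) zero_le_one
      _ = M := one_mul _
  have e3 : ∫ x in ball y (t + h) \ ball y t, 2 * C / (t + h - t) * ‖fderiv ℝ v x‖ ≤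
      ∫ x in ball y (t + h) \ ball y t, (C * h⁻¹ * μ + C / μ * h⁻¹ * ‖fderiv ℝ v x‖ ^ 2) := by
    apply setIntegral_mono_on
    · exact (hi _ (continuousOn_const.mul hDc.norm)).mono_set Set.sdiff_subset
    · exact (hi _ (continuousOn_const.add (continuousOn_const.mul (hDc.norm.pow 2)))).mono_set
        Set.sdiff_subset
    · exact measurableSet_ball.diff measurableSet_ball
    · intro x _
      have : C * h⁻¹ * μ + C / μ * h⁻¹ * ‖fderiv ℝ v x‖ ^ 2 - 2 * C / (t + h - t) * ‖fderiv ℝ v x‖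
        = C * h⁻¹ / μ * (μ - ‖fderiv ℝ v x‖) ^ 2 := by
        rw [add_sub_cancel_left]; field_simp; ring
      have h0 : 0 ≤ C * h⁻¹ / μ * (μ - ‖fderiv ℝ v x‖) ^ 2 := by positivity
      linarith
  have e4 : ∫ x in ball y (t + h) \ ball y t, (C * h⁻¹ * μ + C / μ * h⁻¹ * ‖fderiv ℝ v x‖ ^ 2)
      = C * h⁻¹ * μ * volume.real (ball y (t + h) \ ball y t) +
        C / μ * h⁻¹ * ((∫ x in ball y (t + h), ‖fderiv ℝ v x‖ ^ 2)
        - ∫ x in ball y t, ‖fderiv ℝ v x‖ ^ 2) := by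
    rw [integral_add, setIntegral_const, integral_const_mul,
      hsplit (fun x => ‖fderiv ℝ v x‖ ^ 2) (hDc.norm.pow 2), smul_eq_mul]
    · ring
    · exact (hi _ continuousOn_const).mono_set Set.sdiff_subset
    · exact (hi _ (continuousOn_const.mul (hDc.norm.pow 2))).mono_set Set.sdiff_subset
  have e5 : C * h⁻¹ * μ * volume.real (ball y (t + h) \ ball y t) ≤ C * h⁻¹ * μ * (c * h) := by
    gcongr
  have e6 : C * h⁻¹ * μ * (c * h) = C * μ * c := by field_simp
  have e7 : M * volume.real (ball y (t + h) \ ball y t) ≤ M * (c * h) := by gcongr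
  have e8 := (abs_le.1 (Real.norm_eq_abs _ ▸ e2)).1
  have e9 := (le_abs_self _).trans hcut
  change ∫ x, φ x * laplacian v x ≤ _ at e9
  have e10 : C / μ * h⁻¹ * ((∫ x in ball y (t + h), ‖fderiv ℝ v x‖ ^ 2)
        - ∫ x in ball y t, ‖fderiv ℝ v x‖ ^ 2) = C / μ * (h⁻¹ * ((∫ x in ball y (t + h), ‖fderiv ℝ v x‖ ^ 2)
        - ∫ x in ball y t, ‖fderiv ℝ v x‖ ^ 2)) := by ring
  rw [e1] at e9
  linarith

theorem key {d : ℕ} {C : ℝ} (hC : 0 < C)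
    (hCb : ∀ u, |deriv Real.smoothTransition u| ≤ C)
    (y : EuclideanSpace ℝ (Fin d)) {r t c X : ℝ} (ht : 0 < t) (htr : t < r)
    (v : EuclideanSpace ℝ (Fin d) → ℝ) (hv : ContDiffOn ℝ 2 v (ball y r))
    (hc : c = volume.real (ball (0 : EuclideanSpace ℝ (Fin d)) 1) * d * r ^ (d - 1)) (hc0 : 0 < c)
    (hX : 0 < X) (hXl : X ≤ ∫ x in ball y t, laplacian v x)
    (hG : DifferentiableAt ℝ (fun t => ∫ x in ball y t, ‖fderiv ℝ v x‖ ^ 2) t) :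
    X ^ 2 ≤ 4 * C ^ 2 * c * deriv (fun t => ∫ x in ball y t, ‖fderiv ℝ v x‖ ^ 2) t := by
  set G : ℝ → ℝ := fun t => ∫ x in ball y t, ‖fderiv ℝ v x‖ ^ 2 with hGdef
  obtain ⟨b, htb, hbr⟩ := exists_between htr
  obtain ⟨M, hM⟩ := (isCompact_closedBall y b).exists_bound_of_continuousOn
    ((lap_cont hv).mono (closedBall_subset_ball hbr))
  have hM0 : 0 ≤ M := (norm_nonneg _).trans (hM y (mem_closedBall_self (by linarith)))
  set μ := X / (2 * C * c) with hμd
  have hμ : 0 < μ := by positivity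
  have hs : Tendsto (fun h => h⁻¹ * (G (t + h) - G t)) (nhdsWithin 0 (Set.Ioi 0)) (nhds (deriv G t)) := by
    have := (hasDerivAt_iff_tendsto_slope_zero.1 hG.hasDerivAt)
    simp only [smul_eq_mul] at this
    exact this.mono_left (nhdsWithin_mono _ fun x hx => (ne_of_gt hx))
  have hid : Tendsto (fun h : ℝ => h) (nhdsWithin 0 (Set.Ioi 0)) (nhds 0) :=
    tendsto_id.mono_left nhdsWithin_le_nhds
  have hlim : Tendsto (fun h => C * μ * c + C / μ * (h⁻¹ * (G (t + h) - G t)) + M * c * h)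
      (nhdsWithin 0 (Set.Ioi 0)) (nhds (C * μ * c + C / μ * deriv G t + M * c * 0)) :=
    (tendsto_const_nhds.add (hs.const_mul _)).add (hid.const_mul _)
  have hle : X ≤ C * μ * c + C / μ * deriv G t + M * c * 0 := by
    refine ge_of_tendsto hlim ?_
    filter_upwards [Ioo_mem_nhdsGT (sub_pos.2 htb)] with h hh
    refine hXl.trans (bulk hC hCb y ht hh.1 (by linarith [hh.2]) v hv hc hM0 ?_ hμ)
    intro x hx
    exact hM x (ball_subset_closedBall (ball_subset_ball (by linarith [hh.2]) hx))
  have e1 : C * μ * c = X / 2 := by rw [hμd]; field_simp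
  have e2 : C / μ * deriv G t = 2 * C ^ 2 * c * deriv G t / X := by rw [hμd]; field_simp
  rw [e1, e2, mul_zero, add_zero] at hle
  have : X / 2 ≤ 2 * C ^ 2 * c * deriv G t / X := by linarith
  rw [le_div_iff₀ hX] at this
  nlinarith

theorem statement0 (d : ℕ) (hd : 3 ≤ d) (V : EuclideanSpace ℝ (Fin d) → ℝ)
    (hV : Continuous V) (r R : ℝ) (hr : 0 < r) (hR : 0 < R)
    (lam : EuclideanSpace ℝ (Fin d) → ℝ)
    (hlam : ∀ M : ℝ, ∃ R₁ : ℝ, ∀ y : EuclideanSpace ℝ (Fin d), R₁ ≤ ‖y‖ → M ≤ lam y)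
    (hRicc : ∀ y : EuclideanSpace ℝ (Fin d), R ≤ ‖y‖ →
      ∃ v : EuclideanSpace ℝ (Fin d) → ℝ, ContDiffOn ℝ 2 v (ball y r) ∧
        ∀ x ∈ ball y r, -laplacian v x + ‖gradient v x‖ ^ 2 + lam y = V x) :
    ∀ A > (0:ℝ), ∀ ε > (0:ℝ), ∃ R' > (0:ℝ), ∀ y : EuclideanSpace ℝ (Fin d), R' ≤ ‖y‖ →
      volume {t : ℝ | t ∈ Set.Ioo 0 r ∧ (∫ x in ball y t, V x) ≤ A} ≤ ENNReal.ofReal ε := by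
  intro A hA ε hε
  obtain ⟨C, hC, hCb⟩ := st_deriv_bound
  set ω := volume.real (ball (0 : EuclideanSpace ℝ (Fin d)) 1) with hω
  have hω0 : 0 < ω := by
    rw [hω, measureReal_def]
    exact ENNReal.toReal_pos (measure_ball_pos _ _ one_pos).ne' measure_ball_lt_top.ne
  have hd0 : (0:ℝ) < d := by
    have : 0 < d := by omega
    exact_mod_cast this
  obtain ⟨c, hc⟩ : ∃ c, c = ω * d * r ^ (d - 1) := ⟨_, rfl⟩
  have hc0 : 0 < c := by rw [hc]; positivity
  set κ := 4 * C ^ 2 * c with hκd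
  have hκ : 0 < κ := by positivity
  set δ := min (ε / 4) (r / 4) with hδd
  have hδ : 0 < δ := by positivity
  have hδε : δ ≤ ε / 4 := min_le_left _ _
  have hδr : δ ≤ r / 4 := min_le_right _ _
  obtain ⟨R₁, hR₁⟩ := hlam ((A + 2 * κ / ε) / (ω * δ ^ d))
  refine ⟨max R R₁, lt_max_of_lt_left hR, fun y hy => ?_⟩
  obtain ⟨v, hv, hE⟩ := hRicc y ((le_max_left _ _).trans hy)
  have hl := hR₁ y ((le_max_right _ _).trans hy)
  have hl0 : 0 < lam y := lt_of_lt_of_le (by positivity) hl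
  rw [div_le_iff₀ (by positivity)] at hl
  set K := lam y * (ω * δ ^ d) - A with hKd
  have hKle : 2 * κ / ε ≤ K := by linarith
  have hK : 0 < K := lt_of_lt_of_le (by positivity) hKle
  have hDc : ContinuousOn (fun x => ‖fderiv ℝ v x‖ ^ 2) (ball y r) :=
    ((hv.fderiv_of_isOpen (m := 1) isOpen_ball (by norm_num)).continuousOn).norm.pow 2
  have hi : ∀ f : EuclideanSpace ℝ (Fin d) → ℝ, ContinuousOn f (ball y r) →
      ∀ t < r, IntegrableOn f (ball y t) := fun f hf t ht =>
    ((hf.mono (closedBall_subset_ball ht)).integrableOn_compact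
      (isCompact_closedBall _ _)).mono_set ball_subset_closedBall
  set G : ℝ → ℝ := fun t => ∫ x in ball y t, ‖fderiv ℝ v x‖ ^ 2 with hG
  have hG0 : ∀ t, 0 ≤ G t := fun t => integral_nonneg fun x => by positivity
  have hGm : MonotoneOn G (Set.Icc δ (r - δ)) := by
    intro s hs t ht hst
    exact setIntegral_mono_set (hi _ hDc t (by linarith [ht.2]))
      (Eventually.of_forall fun x => by positivity) (ball_subset_ball hst).eventuallyLE
  have hball : ∀ s : ℝ, 0 < s → volume.real (ball y s) = s ^ d * ω := by
    intro s hs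
    rw [measureReal_def, Measure.addHaar_ball_of_pos _ _ hs]
    simp [measureReal_def, hs.le, hω]
  set S : Set ℝ := {t | t ∈ Set.Ioo δ (r - δ) ∧ (∫ x in ball y t, V x) ≤ A} with hS
  have hone : volume S ≤ ENNReal.ofReal (κ / K) := by
    refine oneD (by linarith) hK hκ hGm (fun t _ => hG0 t) S ?_
    rintro t ⟨ht, htA⟩
    refine ⟨ht, fun hdiff => ?_⟩
    have ht0 : 0 < t := hδ.trans ht.1
    have htr : t < r := by linarith [ht.2]
    refine key hC hCb y ht0 htr v hv hc hc0 (by linarith [hG0 t]) ?_ hdiff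
    have e1 : ∫ x in ball y t, V x =
        (∫ x in ball y t, (‖fderiv ℝ v x‖ ^ 2 + lam y)) - ∫ x in ball y t, laplacian v x := by
      rw [← integral_sub]
      · apply setIntegral_congr_fun measurableSet_ball
        intro x hx
        have hx' := hE x (ball_subset_ball htr.le hx)
        have hn : ‖gradient v x‖ = ‖fderiv ℝ v x‖ := by simp [gradient]
        rw [hn] at hx'
        simp only
        linarith
      · exact hi _ (hDc.add continuousOn_const) t htr
      · exact hi _ (lap_cont hv) t htr
    have e2 : ∫ x in ball y t, (‖fderiv ℝ v x‖ ^ 2 + lam y) = G t + lam y * (ω * t ^ d) := by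
      rw [integral_add (hi _ hDc t htr) (hi _ continuousOn_const t htr)]
      simp [hball t ht0]
      ring
    have e3 : lam y * (ω * δ ^ d) ≤ lam y * (ω * t ^ d) := by
      have := ht.1.le
      gcongr
    linarith
  have hκK : κ / K ≤ ε / 2 := by
    rw [div_le_iff₀ hε] at hKle
    rw [div_le_iff₀ hK]
    linarith
  have hcov : {t : ℝ | t ∈ Set.Ioo 0 r ∧ (∫ x in ball y t, V x) ≤ A} ⊆
      (Set.Icc 0 δ ∪ Set.Icc (r - δ) r) ∪ S := by
    rintro t ⟨ht, htA⟩
    by_cases h1 : t ≤ δ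
    · exact Or.inl (Or.inl ⟨ht.1.le, h1⟩)
    · by_cases h2 : r - δ ≤ t
      · exact Or.inl (Or.inr ⟨h2, ht.2.le⟩)
      · exact Or.inr ⟨⟨not_le.1 h1, not_le.1 h2⟩, htA⟩
  calc _ ≤ volume ((Set.Icc 0 δ ∪ Set.Icc (r - δ) r) ∪ S) := measure_mono hcov
    _ ≤ (volume (Set.Icc 0 δ) + volume (Set.Icc (r - δ) r)) + volume S :=
      (measure_union_le _ _).trans (add_le_add (measure_union_le _ _) le_rfl)
    _ ≤ (ENNReal.ofReal (ε / 4) + ENNReal.ofReal (ε / 4)) + ENNReal.ofReal (ε / 2) := by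
      refine add_le_add (add_le_add ?_ ?_) (hone.trans (ENNReal.ofReal_le_ofReal hκK))
      · rw [Real.volume_Icc]; exact ENNReal.ofReal_le_ofReal (by linarith)
      · rw [Real.volume_Icc]; exact ENNReal.ofReal_le_ofReal (by linarith)
    _ = ENNReal.ofReal ε := by
      rw [← ENNReal.ofReal_add (by positivity) (by positivity),
        ← ENNReal.ofReal_add (by positivity) (by positivity)]
      congr 1; ring
end

section
/- Let d ≥ 3, let V : ℝ^d → ℝ be continuous, and fix r > 0 and R > 0. Suppose there is a function λ : ℝ^d → ℝ with λ(y) → +∞ as |y| → ∞ such that for every y ∈ ℝ^d with |y| ≥ R there exists a twice continuously differentiable function v on the open ball B_r(y) satisfying −Δv(x) + |∇v(x)|² + λ(y) = V(x) for all x ∈ B_r(y). Then the family 𝒱_y(s,t) = ∫_{L_{s,t}(y)} V(x) dx, where L_{s,t}(y) = B_t(y) \ closure(B_s(y)), tends to +∞ in two-dimensional Lebesgue measure on the triangle Δ_r = {(s,t) ∈ ℝ² : 0 < s < t < r} as |y| → ∞; that is, for every A > 0 and ε > 0 there exists R' > 0 such that for all y with |y| ≥ R', mes₂({(s,t) ∈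 Δ_r : 𝒱_y(s,t) ≤ A}) ≤ ε. -/
open MeasureTheory Metric Filter

lemma polar_ball {E : Type*} [NormedAddCommGroup E] [InnerProductSpace ℝ E] [Nontrivial E]
    [MeasurableSpace E] [BorelSpace E] [FiniteDimensional ℝ E] (μ : Measure E) [μ.IsAddHaarMeasure]
    (y : E) {f : E → ℝ} (hf : Continuous f) {t : ℝ} (ht : 0 ≤ t) :
    ∫ x in ball y t, f x ∂μ = ∫ ρ in (0:ℝ)..t, ρ ^ (Module.finrank ℝ E - 1) *
      ∫ w : sphere (0 : E) 1, f (y + ρ • (w : E)) ∂μ.toSphere := by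
  set g : E → ℝ := fun x => (ball (0:E) t).indicator (fun x => f (y + x)) x with hg
  have hgi : Integrable g μ := by
    rw [hg, integrable_indicator_iff measurableSet_ball]
    refine IntegrableOn.mono_set ?_ ball_subset_closedBall
    exact (by fun_prop : Continuous fun x => f (y + x)).continuousOn.integrableOn_compact
      (isCompact_closedBall _ _)
  have h1 : ∫ x in ball y t, f x ∂μ = ∫ x, g x ∂μ := by
    rw [← integral_indicator measurableSet_ball, ← integral_add_left_eq_self _ y]
    congr 1; ext x
    simp [g, Set.indicator]
  have hmp := μ.measurePreserving_homeomorphUnitSphereProd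
  generalize Module.finrank ℝ E - 1 = n at hmp ⊢
  set G : sphere (0:E) 1 × Set.Ioi (0:ℝ) → ℝ := fun p => g ((p.2:ℝ) • (p.1:E)) with hG
  have hcomp : ∀ x : ({(0)}ᶜ : Set E), G (homeomorphUnitSphereProd E x) = g x := by
    intro x
    have hx : (x:E) ≠ 0 := x.2
    simp [G, smul_smul, hx]
  have h2 : ∫ x, g x ∂μ = ∫ p, G p ∂(μ.toSphere.prod (.volumeIoiPow n)) := by
    rw [← hmp.integral_comp (Homeomorph.measurableEmbedding _)]
    simp_rw [hcomp]
    rw [integral_subtype_comap (measurableSet_singleton _).compl g,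
        restrict_compl_singleton]
  have hGi : Integrable G (μ.toSphere.prod (.volumeIoiPow n)) := by
    rw [← hmp.integrable_comp_emb (Homeomorph.measurableEmbedding _)]
    have : G ∘ (homeomorphUnitSphereProd E) = g ∘ (Subtype.val) := by
      ext x; exact hcomp x
    rw [this, ← integrableOn_iff_comap_subtypeVal (measurableSet_singleton _).compl]
    exact hgi.integrableOn
  rw [h1, h2, integral_prod_symm _ hGi]
  simp only [Measure.volumeIoiPow, ENNReal.ofReal]
  rw [integral_withDensity_eq_integral_smul
    ((measurable_subtype_coe.pow_const _).real_toNNReal),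
    integral_subtype_comap measurableSet_Ioi fun a : ℝ ↦ Real.toNNReal (a ^ n) •
      ∫ w : sphere (0 : E) 1, g (a • (w:E)) ∂μ.toSphere]
  rw [intervalIntegral.integral_of_le ht, integral_Ioc_eq_integral_Ioo,
    show Set.Ioo 0 t = Set.Ioi 0 ∩ Set.Iio t from rfl, ← setIntegral_indicator measurableSet_Iio]
  refine setIntegral_congr_fun measurableSet_Ioi fun a ha => ?_
  have ha' : (0:ℝ) < a := ha
  by_cases hat : a < t
  · have : ∀ w : sphere (0:E) 1, a • (w:E) ∈ ball (0:E) t := by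
      intro w; simp [norm_smul, abs_of_pos ha', hat]
    simp only [g, NNReal.smul_def, Set.indicator_of_mem (this _),
      Set.indicator_of_mem (Set.mem_Iio.2 hat), Real.coe_toNNReal _ (pow_nonneg ha'.le _),
      smul_eq_mul]
  · have : ∀ w : sphere (0:E) 1, a • (w:E) ∉ ball (0:E) t := by
      intro w; simp [norm_smul, abs_of_pos ha', not_lt.1 hat]
    simp only [g, Set.indicator_of_notMem (this _),
      Set.indicator_of_notMem (show a ∉ Set.Iio t from hat)]
    simp

lemma sphere_mean_continuous {E : Type*} [NormedAddCommGroup E] [InnerProductSpace ℝ E]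
    [MeasurableSpace E] [BorelSpace E] [FiniteDimensional ℝ E] (μ : Measure E) [μ.IsAddHaarMeasure]
    {f : ℝ → sphere (0 : E) 1 → ℝ} (hf : Continuous f.uncurry) :
    Continuous fun ρ => ∫ w, f ρ w ∂μ.toSphere := by
  have := continuous_parametric_integral_of_continuous (μ := μ.toSphere) hf isCompact_univ
  simpa using this

/-- 1D: weak identity implies the integrated one. -/
lemma twice_diff {F h : ℝ → ℝ} (hF : Continuous F) (hh : Continuous h)
    (H : ∀ t : ℝ, 0 < t → ∫ ρ in (0:ℝ)..t, (t^2-ρ^2)^2 * h ρ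
      = 4 * ∫ ρ in (0:ℝ)..t, (t^2-ρ^2) * (ρ * F ρ)) :
    ∀ t : ℝ, 0 < t → F t = ∫ ρ in (0:ℝ)..t, h ρ := by
  have hd : ∀ {g : ℝ → ℝ}, Continuous g → ∀ t, HasDerivAt (fun t => ∫ ρ in (0:ℝ)..t, g ρ) (g t) t :=
    fun hg t => hg.integral_hasStrictDerivAt 0 t |>.hasDerivAt
  have ii : ∀ {g : ℝ → ℝ}, Continuous g → ∀ a b, IntervalIntegrable g volume a b :=
    fun hg a b => hg.intervalIntegrable a b
  have hh2 : Continuous fun ρ => ρ^2 * h ρ := by fun_prop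
  have hh4 : Continuous fun ρ => ρ^4 * h ρ := by fun_prop
  have hF1 : Continuous fun ρ => ρ * F ρ := by fun_prop
  have hF3 : Continuous fun ρ => ρ^3 * F ρ := by fun_prop
  have e1 : ∀ t : ℝ, ∫ ρ in (0:ℝ)..t, (t^2-ρ^2)^2 * h ρ = t^4 * (∫ ρ in (0:ℝ)..t, h ρ)
      - 2*t^2 * (∫ ρ in (0:ℝ)..t, ρ^2 * h ρ) + ∫ ρ in (0:ℝ)..t, ρ^4 * h ρ := by
    intro t
    rw [← intervalIntegral.integral_const_mul, ← intervalIntegral.integral_const_mul,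
      ← intervalIntegral.integral_sub (ii (by fun_prop) _ _) (ii (by fun_prop) _ _),
      ← intervalIntegral.integral_add (ii (by fun_prop) _ _) (ii (by fun_prop) _ _)]
    congr 1; ext ρ; ring
  have e2 : ∀ t : ℝ, ∫ ρ in (0:ℝ)..t, (t^2-ρ^2) * (ρ * F ρ) = t^2 * (∫ ρ in (0:ℝ)..t, ρ * F ρ)
      - ∫ ρ in (0:ℝ)..t, ρ^3 * F ρ := by
    intro t
    rw [← intervalIntegral.integral_const_mul,
      ← intervalIntegral.integral_sub (ii (by fun_prop) _ _) (ii (by fun_prop) _ _)]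
    congr 1; ext ρ; ring
  have s1 : ∀ t : ℝ, 0 < t → t^2 * (∫ ρ in (0:ℝ)..t, h ρ) - (∫ ρ in (0:ℝ)..t, ρ^2 * h ρ)
      = 2 * ∫ ρ in (0:ℝ)..t, ρ * F ρ := by
    intro t ht
    have d1 := (((hasDerivAt_pow 4 t).mul (hd hh t)).sub
      (((hasDerivAt_pow 2 t).const_mul 2).mul (hd hh2 t))).add (hd hh4 t)
    have d2 := (((hasDerivAt_pow 2 t).mul (hd hF1 t)).sub (hd hF3 t)).const_mul 4
    have := d1.unique (d2.congr_of_eventuallyEq (by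
      filter_upwards [lt_mem_nhds ht] with s hs
      have := H s hs
      rw [e1, e2] at this
      simpa using this))
    simp only [Nat.cast_ofNat] at this
    norm_num at this
    have ht4 : 4 * t ≠ 0 := by positivity
    apply mul_left_cancel₀ ht4
    linear_combination this
  intro t ht
  have d1 := ((hasDerivAt_pow 2 t).mul (hd hh t)).sub (hd hh2 t)
  have d2 := (hd hF1 t).const_mul 2
  have := d1.unique (d2.congr_of_eventuallyEq (by
      filter_upwards [lt_mem_nhds ht] with s hs
      have := s1 s hs
      simpa using this))
  norm_num at this
  have ht4 : 2 * t ≠ 0 := by positivity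
  apply mul_left_cancel₀ ht4
  linear_combination -this

lemma hasDerivAt_max_sq (z : ℝ) : HasDerivAt (fun z : ℝ => (max z 0) ^ 2) (2 * max z 0) z := by
  rcases lt_trichotomy z 0 with hz | hz | hz
  · rw [max_eq_right hz.le, mul_zero]
    refine (hasDerivAt_const z (0:ℝ)).congr_of_eventuallyEq ?_
    filter_upwards [gt_mem_nhds hz] with s hs
    simp [max_eq_right hs.le]
  · subst hz
    rw [hasDerivAt_iff_isLittleO]
    simp only [max_self, sub_zero, mul_zero, smul_zero]
    refine Asymptotics.IsBigO.trans_isLittleO (g := fun x : ℝ => x ^ 2) ?_ ?_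
    · refine Asymptotics.IsBigO.of_bound 1 (Eventually.of_forall fun x => ?_)
      rcases le_total x 0 with h | h
      · simp [max_eq_right h, sq_nonneg]
      · simp [max_eq_left h]
    · simpa using Asymptotics.isLittleO_pow_id (𝕜 := ℝ) (n := 2) (by norm_num)
  · rw [max_eq_left hz.le]
    refine (by simpa using hasDerivAt_pow 2 z : HasDerivAt (fun z : ℝ => z ^ 2) (2 * z) z).congr_of_eventuallyEq ?_
    filter_upwards [lt_mem_nhds hz] with s hs
    simp [max_eq_left hs.le]

lemma laplacian_continuous {d : ℕ} {w : EuclideanSpace ℝ (Fin d) → ℝ} (hw : ContDiff ℝ 2 w) :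
    Continuous (laplacian w) := by
  have h1 : ContDiff ℝ 1 (fderiv ℝ w) := hw.fderiv_right (by norm_num)
  have h2 : Continuous (fderiv ℝ (fderiv ℝ w)) := h1.continuous_fderiv (by norm_num)
  unfold laplacian
  fun_prop

lemma ibp_ball {d : ℕ} {w : EuclideanSpace ℝ (Fin d) → ℝ} (hw : ContDiff ℝ 2 w)
    (y : EuclideanSpace ℝ (Fin d)) {t : ℝ} (ht : 0 < t) :
    ∫ x in ball y t, (t ^ 2 - ‖x - y‖ ^ 2) ^ 2 * laplacian w x
      = 4 * ∫ x in ball y t, (t ^ 2 - ‖x - y‖ ^ 2) * fderiv ℝ w x (x - y) := by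
  have h1 : ContDiff ℝ 1 (fderiv ℝ w) := hw.fderiv_right (by norm_num)
  have h0 : Continuous (fderiv ℝ w) := h1.continuous
  have h2 : Continuous (fderiv ℝ (fderiv ℝ w)) := h1.continuous_fderiv (by norm_num)
  have hl := laplacian_continuous hw
  set m : EuclideanSpace ℝ (Fin d) → ℝ := fun x => max (t ^ 2 - ‖x - y‖ ^ 2) 0 with hm
  have hmc : Continuous m := by fun_prop
  have hin : ∀ x ∈ ball y t, m x = t ^ 2 - ‖x - y‖ ^ 2 := by
    intro x hx
    rw [mem_ball, dist_eq_norm] at hx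
    exact max_eq_left (by nlinarith [norm_nonneg (x - y)])
  have hout : ∀ x, x ∉ ball y t → m x = 0 := by
    intro x hx
    rw [mem_ball, dist_eq_norm, not_lt] at hx
    exact max_eq_right (by nlinarith [norm_nonneg (x - y)])
  have hcs : HasCompactSupport m := by
    refine HasCompactSupport.intro (isCompact_closedBall y t) fun x hx => hout x fun h => hx (ball_subset_closedBall h)
  have hint : ∀ g : EuclideanSpace ℝ (Fin d) → ℝ, Continuous g → Integrable fun x => m x * g x :=
    fun g hg => (hmc.mul hg).integrable_of_hasCompactSupport hcs.mul_right
  have hder : ∀ x, HasFDerivAt (fun x => m x ^ 2) ((-4 * m x) • innerSL ℝ (x - y)) x := by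
    intro x
    have e1 : HasFDerivAt (fun x => t ^ 2 - ‖x - y‖ ^ 2) (-(2 • innerSL ℝ (x - y))) x := by
      have := ((hasFDerivAt_id x).sub_const y).norm_sq
      simpa using this.const_sub (t ^ 2)
    have := (hasDerivAt_max_sq (t ^ 2 - ‖x - y‖ ^ 2)).comp_hasFDerivAt x e1
    refine this.congr_fderiv ?_
    ext z
    simp [hm]
    ring
  have hi : ∀ i : Fin d, ∫ x, m x ^ 2 * fderiv ℝ (fderiv ℝ w) x (EuclideanSpace.single i 1) (EuclideanSpace.single i 1)
      = 4 * ∫ x, m x * ((x - y) i * fderiv ℝ w x (EuclideanSpace.single i 1)) := by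
    intro i
    have hg : ∀ x, HasFDerivAt (fun x => fderiv ℝ w x (EuclideanSpace.single i 1))
        ((fderiv ℝ (fderiv ℝ w) x).flip (EuclideanSpace.single i 1)) x := by
      intro x
      have e := ((h1.differentiable (by norm_num) x).hasFDerivAt)
      exact ((ContinuousLinearMap.apply ℝ ℝ
        (EuclideanSpace.single i (1:ℝ))).hasFDerivAt.comp x e).congr_fderiv (by ext; rfl)
    have key := integral_bilinear_hasFDerivAt_right_eq_neg_left_of_integrable
      (μ := (volume : Measure (EuclideanSpace ℝ (Fin d))))
      (B := ContinuousLinearMap.mul ℝ ℝ) (v := EuclideanSpace.single i 1)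
      (f := fun x => m x ^ 2) (f' := fun x => (-4 * m x) • innerSL ℝ (x - y))
      (g := fun x => fderiv ℝ w x (EuclideanSpace.single i 1))
      (g' := fun x => (fderiv ℝ (fderiv ℝ w) x).flip (EuclideanSpace.single i 1))
      ?_ ?_ ?_ (fun x _ => hder x) (fun x _ => hg x)
    · simp only [ContinuousLinearMap.mul_apply', ContinuousLinearMap.flip_apply] at key
      rw [key, ← integral_neg, ← integral_const_mul]
      congr 1; ext x
      simp [EuclideanSpace.inner_single_right]
      ring
    · refine (hint (fun x => -4 * ((x - y) i * fderiv ℝ w x (EuclideanSpace.single i 1))) (by fun_prop)).congr (Eventually.of_forall fun x => ?_)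
      simp only
      simp [EuclideanSpace.inner_single_right]
      ring
    · refine (hint (fun x => m x * fderiv ℝ (fderiv ℝ w) x (EuclideanSpace.single i 1) (EuclideanSpace.single i 1)) (by fun_prop)).congr (Eventually.of_forall fun x => ?_)
      simp only
      simp
      ring
    · refine (hint (fun x => m x * fderiv ℝ w x (EuclideanSpace.single i 1)) (by fun_prop)).congr (Eventually.of_forall fun x => ?_)
      simp only
      simp
      ring
  have hsum : ∀ x, fderiv ℝ w x (x - y) = ∑ i, (x - y) i * fderiv ℝ w x (EuclideanSpace.single i 1) := by
    intro x
    have : x - y = ∑ i, (x - y) i • EuclideanSpace.single i (1:ℝ) := by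
      ext j; simp [Finset.sum_apply, Pi.single_apply]
    conv_lhs => rw [this]
    simp [map_sum]
  have L : ∫ x in ball y t, (t ^ 2 - ‖x - y‖ ^ 2) ^ 2 * laplacian w x = ∫ x, m x ^ 2 * laplacian w x := by
    rw [← setIntegral_eq_integral_of_forall_compl_eq_zero (s := ball y t) (μ := volume)
      (f := fun x => m x ^ 2 * laplacian w x) (fun x hx => by rw [hout x hx]; ring)]
    exact setIntegral_congr_fun measurableSet_ball fun x hx => by simp only [hin x hx]
  have Rr : ∫ x in ball y t, (t ^ 2 - ‖x - y‖ ^ 2) * fderiv ℝ w x (x - y) = ∫ x, m x * fderiv ℝ w x (x - y) := by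
    rw [← setIntegral_eq_integral_of_forall_compl_eq_zero (s := ball y t) (μ := volume)
      (f := fun x => m x * fderiv ℝ w x (x - y)) (fun x hx => by rw [hout x hx]; ring)]
    exact setIntegral_congr_fun measurableSet_ball fun x hx => by simp only [hin x hx]
  rw [L, Rr]
  simp_rw [hsum, laplacian, Finset.mul_sum]
  rw [integral_finsetSum, integral_finsetSum, Finset.mul_sum]
  · exact Finset.sum_congr rfl fun i _ => hi i
  · intro i _
    exact hint _ (by fun_prop)
  · intro i _
    refine (hint (fun x => m x * fderiv ℝ (fderiv ℝ w) x (EuclideanSpace.single i 1) (EuclideanSpace.single i 1)) (by fun_prop)).congr (Eventually.of_forall fun x => ?_)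
    simp only
    ring

/-- one-dim estimate -/
lemma slice_est {S : Set ℝ} (hS : MeasurableSet S) {ψ ψ' : ℝ → ℝ} {c a K : ℝ} (hc : 0 < c)
    (hd : ∀ x ∈ S, HasDerivAt ψ (ψ' x) x) (hm : MonotoneOn ψ S) (hψ : ∀ x ∈ S, c ≤ ψ' x)
    (hr : ∀ x ∈ S, ψ x ∈ Set.Icc a (a + K)) : volume S ≤ ENNReal.ofReal (K / c) := by
  have h := lintegral_deriv_eq_volume_image_of_monotoneOn hS
    (fun x hx => (hd x hx).hasDerivWithinAt) hm
  have h1 : volume (ψ '' S) ≤ ENNReal.ofReal K := by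
    refine (measure_mono (Set.image_subset_iff.2 (show S ⊆ ψ ⁻¹' Set.Icc a (a + K) from hr))).trans ?_
    simp
  have h2 : ENNReal.ofReal c * volume S ≤ ∫⁻ x in S, ENNReal.ofReal (ψ' x) := by
    rw [← setLIntegral_const]
    exact setLIntegral_mono' hS fun x hx => ENNReal.ofReal_le_ofReal (hψ x hx)
  rw [ENNReal.ofReal_div_of_pos hc, ENNReal.le_div_iff_mul_le (by simp [hc]) (by simp), mul_comm]
  exact h2.trans (h.trans_le h1)

lemma prod_est {S : Set (ℝ × ℝ)} (hS : MeasurableSet S) {r K : ℝ} (hr : 0 < r)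
    (h0 : ∀ p ∈ S, p.1 ∈ Set.Ioo 0 r) (hK : ∀ s, 0 < s → s < r → volume (Prod.mk s ⁻¹' S) ≤ ENNReal.ofReal K) :
    volume S ≤ ENNReal.ofReal (r * K) := by
  rw [Measure.volume_eq_prod, Measure.prod_apply hS]
  have : ∀ s, volume (Prod.mk s ⁻¹' S) ≤ (Set.Ioo 0 r).indicator (fun _ => ENNReal.ofReal K) s := by
    intro s
    by_cases hs : s ∈ Set.Ioo 0 r
    · rw [Set.indicator_of_mem hs]; exact hK s hs.1 hs.2
    · rw [Set.indicator_of_notMem hs]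
      have : Prod.mk s ⁻¹' S = ∅ := by
        ext t; simp only [Set.mem_preimage, Set.mem_empty_iff_false, iff_false]
        exact fun h => hs (h0 _ h)
      simp [this]
  refine (lintegral_mono this).trans ?_
  rw [lintegral_indicator measurableSet_Ioo, setLIntegral_const]
  simp [ENNReal.ofReal_mul hr.le, mul_comm]

lemma core_est {r C M δ A : ℝ} (hr : 0 < r) (hC : 0 < C) (hM : 0 < M) (hA : 2 * A ≤ M) (hδ : 0 < δ)
    {Φ Φ' F : ℝ → ℝ} (hΦm : Measurable Φ) (hFm : Measurable F)
    (hder : ∀ t, 0 < t → t < r → HasDerivAt Φ (Φ' t) t)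
    (hineq : ∀ t, 0 < t → t < r → F t ^ 2 ≤ C * Φ' t)
    (hmono : MonotoneOn Φ (Set.Ioo 0 r))
    (hinc : ∀ s t, 0 < s → s + δ ≤ t → t < r → M ≤ Φ t - Φ s) :
    volume {p : ℝ × ℝ | 0 < p.1 ∧ p.1 < p.2 ∧ p.2 < r ∧
      (Φ p.2 - F p.2) - (Φ p.1 - F p.1) ≤ A} ≤ ENNReal.ofReal (r * δ + r * (32 * C / M)) := by
  set B0 : Set (ℝ × ℝ) := {p | 0 < p.1 ∧ p.1 < r ∧ p.1 < p.2 ∧ p.2 < p.1 + δ} with hB0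
  set B1 : Set (ℝ × ℝ) := {p | 0 < p.1 ∧ p.1 + δ ≤ p.2 ∧ p.2 < r ∧
    Φ p.2 - Φ p.1 ≤ 4 * |F p.2|} with hB1
  set B2 : Set (ℝ × ℝ) := {p | 0 < p.2 ∧ p.2 + δ ≤ p.1 ∧ p.1 < r ∧
    Φ p.1 - Φ p.2 ≤ 4 * |F p.2|} with hB2
  have key : ∀ u f q : ℝ, 0 < u → u ≤ 4 * |f| → f ^ 2 ≤ C * q → 1 / (16 * C) ≤ q / u ^ 2 := by
    intro u f q hu huf hf
    rw [div_le_div_iff₀ (by positivity) (by positivity)]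
    have : u ^ 2 ≤ 16 * f ^ 2 := by
      rw [← sq_abs f]; nlinarith [abs_nonneg f]
    linarith
  have mF : Measurable fun p : ℝ × ℝ => 4 * |F p.2| :=
    ((hFm.comp measurable_snd).abs).const_mul 4
  have mP1 : Measurable fun p : ℝ × ℝ => Φ p.1 := hΦm.comp measurable_fst
  have mP2 : Measurable fun p : ℝ × ℝ => Φ p.2 := hΦm.comp measurable_snd
  have m0 : MeasurableSet B0 :=
    (measurableSet_lt measurable_const measurable_fst).inter
      ((measurableSet_lt measurable_fst measurable_const).inter
      ((measurableSet_lt measurable_fst measurable_snd).inter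
       (measurableSet_lt measurable_snd (measurable_fst.add_const δ))))
  have m1 : MeasurableSet B1 :=
    (measurableSet_lt measurable_const measurable_fst).inter
      ((measurableSet_le (measurable_fst.add_const δ) measurable_snd).inter
      ((measurableSet_lt measurable_snd measurable_const).inter
       (measurableSet_le (mP2.sub mP1) mF)))
  have m2 : MeasurableSet B2 :=
    (measurableSet_lt measurable_const measurable_snd).inter
      ((measurableSet_le (measurable_snd.add_const δ) measurable_fst).inter
      ((measurableSet_lt measurable_fst measurable_const).inter
       (measurableSet_le (mP1.sub mP2) mF)))
  have v0 : volume B0 ≤ ENNReal.ofReal (r * δ) := by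
    refine prod_est m0 hr (fun p hp => ⟨hp.1, hp.2.1⟩) fun s hs hsr => ?_
    refine (measure_mono (t := Set.Ioo s (s + δ)) fun t ht => ⟨ht.2.2.1, ht.2.2.2⟩).trans ?_
    simp
  have hKeq : (1 / M) / (1 / (16 * C)) = 16 * C / M := by field_simp
  have v1 : volume B1 ≤ ENNReal.ofReal (r * (16 * C / M)) := by
    refine prod_est m1 hr (fun p hp => ⟨hp.1, by linarith [hp.2.1, hp.2.2.1]⟩) fun s hs hsr => ?_
    rw [← hKeq]
    refine slice_est (measurable_prodMk_left m1) (ψ := fun t => - (Φ t - Φ s)⁻¹)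
      (ψ' := fun t => Φ' t / (Φ t - Φ s) ^ 2) (a := - (1 / M)) (by positivity) ?_ ?_ ?_ ?_
    · rintro t ⟨h1, h2, h3, h4⟩
      simp only at h1 h2 h3 h4
      have hu := hinc s t h1 h2 h3
      refine (((hder t (by linarith) h3).sub_const (Φ s)).fun_inv (by linarith)).fun_neg.congr_deriv ?_
      simp [neg_div]
    · rintro t ⟨h1, h2, h3, h4⟩ t' ⟨h1', h2', h3', h4'⟩ htt
      simp only at h1 h2 h3 h4 h1' h2' h3' h4'
      have hu := hinc s t h1 h2 h3
      have := hmono ⟨by linarith, h3⟩ ⟨by linarith, h3'⟩ htt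
      simp only [neg_le_neg_iff]
      exact inv_anti₀ (by linarith) (by linarith)
    · rintro t ⟨h1, h2, h3, h4⟩
      simp only at h1 h2 h3 h4
      have hu := hinc s t h1 h2 h3
      exact key _ _ _ (by linarith) h4 (hineq t (by linarith) h3)
    · rintro t ⟨h1, h2, h3, h4⟩
      simp only at h1 h2 h3 h4
      have hu := hinc s t h1 h2 h3
      have h5 : (Φ t - Φ s)⁻¹ ≤ 1 / M := by rw [one_div]; exact inv_anti₀ hM hu
      have h6 : 0 ≤ (Φ t - Φ s)⁻¹ := inv_nonneg.2 (by linarith)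
      exact ⟨by linarith, by linarith⟩
  have v2 : volume B2 ≤ ENNReal.ofReal (r * (16 * C / M)) := by
    refine prod_est m2 hr (fun p hp => ⟨by linarith [hp.1, hp.2.1], hp.2.2.1⟩) fun t ht htr => ?_
    rw [← hKeq]
    refine slice_est (measurable_prodMk_left m2) (ψ := fun s => (Φ t - Φ s)⁻¹)
      (ψ' := fun s => Φ' s / (Φ t - Φ s) ^ 2) (a := 0) (by positivity) ?_ ?_ ?_ ?_
    · rintro s ⟨h1, h2, h3, h4⟩
      simp only at h1 h2 h3 h4
      have hu := hinc s t h1 h2 h3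
      refine (((hder s h1 (by linarith)).const_sub (Φ t)).fun_inv (by linarith)).congr_deriv ?_
      simp [neg_div]
    · rintro s ⟨h1, h2, h3, h4⟩ s' ⟨h1', h2', h3', h4'⟩ hss
      simp only at h1 h2 h3 h4 h1' h2' h3' h4'
      have hu := hinc s' t h1' h2' h3'
      have := hmono ⟨h1, by linarith⟩ ⟨h1', by linarith⟩ hss
      exact inv_anti₀ (by linarith) (by linarith)
    · rintro s ⟨h1, h2, h3, h4⟩
      simp only at h1 h2 h3 h4
      have hu := hinc s t h1 h2 h3
      exact key _ _ _ (by linarith) h4 (hineq s h1 (by linarith))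
    · rintro s ⟨h1, h2, h3, h4⟩
      simp only at h1 h2 h3 h4
      have hu := hinc s t h1 h2 h3
      have h5 : (Φ t - Φ s)⁻¹ ≤ 1 / M := by rw [one_div]; exact inv_anti₀ hM hu
      have h6 : 0 ≤ (Φ t - Φ s)⁻¹ := inv_nonneg.2 (by linarith)
      exact ⟨by linarith, by linarith⟩
  have v2' : volume (Prod.swap ⁻¹' B2) ≤ ENNReal.ofReal (r * (16 * C / M)) := by
    rw [Measure.volume_eq_prod, Measure.measurePreserving_swap.measure_preimage m2.nullMeasurableSet,
      ← Measure.volume_eq_prod]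
    exact v2
  have hsub : {p : ℝ × ℝ | 0 < p.1 ∧ p.1 < p.2 ∧ p.2 < r ∧
      (Φ p.2 - F p.2) - (Φ p.1 - F p.1) ≤ A} ⊆ B0 ∪ (B1 ∪ Prod.swap ⁻¹' B2) := by
    rintro ⟨s, t⟩ ⟨h1, h2, h3, h4⟩
    simp only at h1 h2 h3 h4
    by_cases hst : t < s + δ
    · exact Or.inl ⟨h1, by simp only; linarith, h2, hst⟩
    · push Not at hst
      have hu := hinc s t h1 hst h3
      right
      by_cases hb : Φ t - Φ s ≤ 4 * |F t|
      · exact Or.inl ⟨h1, hst, h3, hb⟩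
      · refine Or.inr ⟨h1, hst, h3, ?_⟩
        simp only [Prod.swap]
        push Not at hb
        have := le_abs_self (F t)
        have := neg_abs_le (F s)
        linarith
  refine (measure_mono hsub).trans ((measure_union_le _ _).trans ?_)
  refine (add_le_add v0 ((measure_union_le _ _).trans (add_le_add v1 v2'))).trans ?_
  rw [← ENNReal.ofReal_add (by positivity) (by positivity),
    ← ENNReal.ofReal_add (by positivity) (by positivity)]
  apply le_of_eq; congr 1; ring

lemma cs_sphere {X : Type*} [MeasurableSpace X] (μ : Measure X) [IsFiniteMeasure μ]
    {f : X → ℝ} (hf : Integrable f μ) (hf2 : Integrable (fun x => f x ^ 2) μ)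
    (hpos : 0 < μ.real Set.univ) :
    (∫ x, f x ∂μ) ^ 2 ≤ μ.real Set.univ * ∫ x, f x ^ 2 ∂μ := by
  set σ := μ.real Set.univ
  set I := ∫ x, f x ∂μ with hI
  have h : 0 ≤ ∫ x, (σ * f x - I) ^ 2 ∂μ := integral_nonneg fun x => sq_nonneg _
  have e : ∫ x, (σ * f x - I) ^ 2 ∂μ = σ ^ 2 * (∫ x, f x ^ 2 ∂μ) - 2 * σ * I * I + σ * I ^ 2 := by
    have : ∀ x, (σ * f x - I) ^ 2 = σ ^ 2 * f x ^ 2 - 2 * σ * I * f x + I ^ 2 := fun x => by ring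
    simp_rw [this]
    have i1 : Integrable (fun x => σ ^ 2 * f x ^ 2 - 2 * σ * I * f x) μ :=
      (hf2.const_mul _).sub (hf.const_mul _)
    rw [integral_add i1 (integrable_const _),
      integral_sub (hf2.const_mul _) (hf.const_mul _), integral_const_mul, integral_const_mul,
      integral_const, smul_eq_mul]
  rw [e] at h
  have h' : 0 ≤ σ * (σ * (∫ x, f x ^ 2 ∂μ) - I ^ 2) := by linarith
  have := nonneg_of_mul_nonneg_right h' hpos
  linarith

lemma sphere_integrable {d : ℕ} {f : sphere (0 : EuclideanSpace ℝ (Fin d)) 1 → ℝ}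
    (hf : Continuous f) :
    Integrable f (volume : Measure (EuclideanSpace ℝ (Fin d))).toSphere := by
  rw [← integrableOn_univ]
  exact hf.continuousOn.integrableOn_compact isCompact_univ

lemma flux_eq {d : ℕ} (hd : 3 ≤ d) {w : EuclideanSpace ℝ (Fin d) → ℝ} (hw : ContDiff ℝ 2 w)
    (y : EuclideanSpace ℝ (Fin d)) : ∀ t : ℝ, 0 < t →
    t ^ (d - 1) * (∫ z : sphere (0 : EuclideanSpace ℝ (Fin d)) 1,
        fderiv ℝ w (y + t • (z : EuclideanSpace ℝ (Fin d))) (z : EuclideanSpace ℝ (Fin d))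
          ∂(volume : Measure (EuclideanSpace ℝ (Fin d))).toSphere)
      = ∫ ρ in (0:ℝ)..t, ρ ^ (d - 1) * ∫ z : sphere (0 : EuclideanSpace ℝ (Fin d)) 1,
          laplacian w (y + ρ • (z : EuclideanSpace ℝ (Fin d)))
          ∂(volume : Measure (EuclideanSpace ℝ (Fin d))).toSphere := by
  have : Nonempty (Fin d) := ⟨⟨0, by omega⟩⟩
  have h1 : ContDiff ℝ 1 (fderiv ℝ w) := hw.fderiv_right (by norm_num)
  have h0 : Continuous (fderiv ℝ w) := h1.continuous
  have hl := laplacian_continuous hw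
  have hfr : Module.finrank ℝ (EuclideanSpace ℝ (Fin d)) = d := by simp
  refine twice_diff
    (F := fun t => t ^ (d - 1) * (∫ z : sphere (0 : EuclideanSpace ℝ (Fin d)) 1,
        fderiv ℝ w (y + t • (z : EuclideanSpace ℝ (Fin d))) (z : EuclideanSpace ℝ (Fin d))
          ∂(volume : Measure (EuclideanSpace ℝ (Fin d))).toSphere))
    ((continuous_pow _).mul (sphere_mean_continuous _ ?_))
    ((continuous_pow _).mul (sphere_mean_continuous _ ?_)) ?_
  · simp only [Function.uncurry_def]; fun_prop
  · simp only [Function.uncurry_def]; fun_prop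
  · intro t ht
    have hnorm : ∀ (ρ : ℝ) (z : sphere (0 : EuclideanSpace ℝ (Fin d)) 1),
        ‖ρ • (z : EuclideanSpace ℝ (Fin d))‖ ^ 2 = ρ ^ 2 := by
      intro ρ z; simp [norm_smul]
    have e := ibp_ball hw y ht
    rw [polar_ball volume y (by fun_prop) ht.le, polar_ball volume y (by fun_prop) ht.le, hfr] at e
    simp only [add_sub_cancel_left, hnorm, integral_const_mul, map_smul, smul_eq_mul] at e
    convert e using 1
    · congr 1; ext ρ; ring
    · congr 2; ext ρ; ring

lemma global_est {d : ℕ} (hd : 3 ≤ d) {V w : EuclideanSpace ℝ (Fin d) → ℝ} (hV : Continuous V)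
    (hw : ContDiff ℝ 2 w) (y : EuclideanSpace ℝ (Fin d)) {r lam δ M A σ : ℝ} (hr : 0 < r)
    (hlam : 0 < lam) (hδ : 0 < δ) (hM : 0 < M) (hA : 2 * A ≤ M)
    (hσ : σ = (volume : Measure (EuclideanSpace ℝ (Fin d))).toSphere.real Set.univ) (hσ0 : 0 < σ)
    (hMl : M ≤ lam * σ / d * δ ^ d)
    (hRicc : ∀ x ∈ ball y r, -laplacian w x + ‖gradient w x‖ ^ 2 + lam = V x) :
    volume {p : ℝ × ℝ | 0 < p.1 ∧ p.1 < p.2 ∧ p.2 < r ∧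
        (∫ x in ball y p.2 \ closure (ball y p.1), V x) ≤ A}
      ≤ ENNReal.ofReal (r * δ + r * (32 * (σ * r ^ (d - 1)) / M)) := by
  have : Nonempty (Fin d) := ⟨⟨0, by omega⟩⟩
  have h1 : ContDiff ℝ 1 (fderiv ℝ w) := hw.fderiv_right (by norm_num)
  have h0 : Continuous (fderiv ℝ w) := h1.continuous
  have hl := laplacian_continuous hw
  have hfr : Module.finrank ℝ (EuclideanSpace ℝ (Fin d)) = d := by simp
  have hgr : ∀ x, ‖gradient w x‖ = ‖fderiv ℝ w x‖ := fun x => by simp [gradient]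
  simp only [hgr] at hRicc
  set μ := (volume : Measure (EuclideanSpace ℝ (Fin d))).toSphere with hμ
  set F : ℝ → ℝ := fun t => t ^ (d - 1) * ∫ z : sphere (0 : EuclideanSpace ℝ (Fin d)) 1,
        fderiv ℝ w (y + t • (z : EuclideanSpace ℝ (Fin d))) (z : EuclideanSpace ℝ (Fin d)) ∂μ with hF
  set Q : ℝ → ℝ := fun t => t ^ (d - 1) * ∫ z : sphere (0 : EuclideanSpace ℝ (Fin d)) 1,
        ‖fderiv ℝ w (y + t • (z : EuclideanSpace ℝ (Fin d)))‖ ^ 2 ∂μ with hQ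
  set h : ℝ → ℝ := fun t => t ^ (d - 1) * ∫ z : sphere (0 : EuclideanSpace ℝ (Fin d)) 1,
        laplacian w (y + t • (z : EuclideanSpace ℝ (Fin d))) ∂μ with hh
  have cF : Continuous F := by
    refine (continuous_pow _).mul (sphere_mean_continuous _ ?_)
    simp only [Function.uncurry_def]; fun_prop
  have cQ : Continuous Q := by
    refine (continuous_pow _).mul (sphere_mean_continuous _ ?_)
    simp only [Function.uncurry_def]; fun_prop
  have ch : Continuous h := by
    refine (continuous_pow _).mul (sphere_mean_continuous _ ?_)
    simp only [Function.uncurry_def]; fun_prop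
  have hFh : ∀ t, 0 < t → F t = ∫ ρ in (0:ℝ)..t, h ρ := flux_eq hd hw y
  set P : ℝ → ℝ := fun t => Q t + lam * σ * t ^ (d - 1) with hP
  have cP : Continuous P := by fun_prop
  set Φ : ℝ → ℝ := fun t => ∫ ρ in (0:ℝ)..t, P ρ with hΦ
  have dΦ : ∀ t, HasDerivAt Φ (P t) t := fun t =>
    (cP.integral_hasStrictDerivAt 0 t).hasDerivAt
  have Q0 : ∀ t, 0 ≤ t → 0 ≤ Q t := fun t ht =>
    mul_nonneg (pow_nonneg ht _) (integral_nonneg fun z => sq_nonneg _)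
  have hincr : ∀ s t, 0 ≤ s → s ≤ t → lam * σ / d * (t - s) ^ d ≤ Φ t - Φ s := by
    intro s t hs hst
    have e1 : Φ t - Φ s = ∫ ρ in s..t, P ρ :=
      intervalIntegral.integral_interval_sub_left (cP.intervalIntegrable _ _)
        (cP.intervalIntegrable _ _)
    have e2 : ∫ ρ in s..t, lam * σ * ρ ^ (d - 1) ≤ ∫ ρ in s..t, P ρ := by
      refine intervalIntegral.integral_mono_on hst
        ((by fun_prop : Continuous _).intervalIntegrable _ _) (cP.intervalIntegrable _ _) ?_
      intro x hx
      have := Q0 x (hs.trans hx.1)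
      simp only [hP]; linarith
    rw [intervalIntegral.integral_const_mul, integral_pow] at e2
    have e3 : d - 1 + 1 = d := by omega
    have e4 : ((d - 1 : ℕ) : ℝ) + 1 = d := by exact_mod_cast e3
    rw [e3, e4] at e2
    have e5 : (t - s) ^ d ≤ t ^ d - s ^ d := by
      have := pow_add_pow_le (sub_nonneg.2 hst) hs (n := d) (by omega)
      rw [sub_add_cancel] at this
      linarith
    rw [e1]
    refine le_trans ?_ e2
    rw [mul_div_assoc', div_mul_eq_mul_div]
    gcongr
  have hW : ∀ t, 0 < t → t < r → ∫ x in ball y t, V x = Φ t - F t := by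
    intro t ht htr
    have e1 : ∫ x in ball y t, V x
        = ∫ x in ball y t, (-laplacian w x + ‖fderiv ℝ w x‖ ^ 2 + lam) :=
      setIntegral_congr_fun measurableSet_ball fun x hx =>
        (hRicc x (ball_subset_ball htr.le hx)).symm
    rw [e1, polar_ball volume y (by fun_prop) ht.le, hfr, hFh t ht]
    simp only [hΦ]
    rw [← intervalIntegral.integral_sub (cP.intervalIntegrable _ _) (ch.intervalIntegrable _ _)]
    congr 1; ext ρ
    rw [integral_add, integral_add, integral_neg, integral_const, smul_eq_mul, ← hμ, ← hσ]
    · simp only [hP, hQ, hh]; ring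
    · exact sphere_integrable (by fun_prop)
    · exact sphere_integrable (by fun_prop)
    · exact sphere_integrable (by fun_prop)
    · exact sphere_integrable (by fun_prop)
  have hcore := core_est (r := r) (C := σ * r ^ (d - 1)) (M := M) (δ := δ) (A := A) hr
    (by positivity) hM hA hδ (Φ := Φ) (Φ' := P) (F := F)
    (continuous_iff_continuousAt.2 fun t => (dΦ t).continuousAt).measurable cF.measurable
    (fun t _ _ => dΦ t) ?_ ?_ ?_
  · refine (measure_mono ?_).trans hcore
    rintro ⟨s, t⟩ ⟨hs, hst, htr, hle⟩
    simp only at hs hst htr hle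
    refine ⟨hs, hst, htr, ?_⟩
    simp only
    rw [← hW s hs (hst.trans htr), ← hW t (hs.trans hst) htr]
    have hi : ∀ u, IntegrableOn V (ball y u) := fun u =>
      (hV.continuousOn.integrableOn_compact (isCompact_closedBall y u)).mono_set
        ball_subset_closedBall
    rw [closure_ball y hs.ne', setIntegral_sdiff isClosed_closedBall.measurableSet (hi t)
      (closedBall_subset_ball hst)] at hle
    rwa [setIntegral_congr_set (show ball y s =ᵐ[volume] closedBall y s from
      ae_eq_of_subset_of_measure_ge ball_subset_closedBall
        (Measure.addHaar_closedBall_eq_addHaar_ball volume y s).le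
        measurableSet_ball.nullMeasurableSet measure_closedBall_lt_top.ne)]
  · intro t ht htr
    have a1 := cs_sphere μ (f := fun z : sphere (0 : EuclideanSpace ℝ (Fin d)) 1 =>
      fderiv ℝ w (y + t • (z : EuclideanSpace ℝ (Fin d))) (z : EuclideanSpace ℝ (Fin d)))
      (sphere_integrable (by fun_prop)) (sphere_integrable (by fun_prop)) (hσ ▸ hσ0)
    have a2 : ∫ z : sphere (0 : EuclideanSpace ℝ (Fin d)) 1,
        (fderiv ℝ w (y + t • (z : EuclideanSpace ℝ (Fin d))) (z : EuclideanSpace ℝ (Fin d))) ^ 2 ∂μ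
        ≤ ∫ z : sphere (0 : EuclideanSpace ℝ (Fin d)) 1,
          ‖fderiv ℝ w (y + t • (z : EuclideanSpace ℝ (Fin d)))‖ ^ 2 ∂μ := by
      refine integral_mono (sphere_integrable (by fun_prop)) (sphere_integrable (by fun_prop)) ?_
      intro z
      have := (fderiv ℝ w (y + t • (z : EuclideanSpace ℝ (Fin d)))).le_opNorm
        (z : EuclideanSpace ℝ (Fin d))
      rw [norm_eq_of_mem_sphere z, mul_one] at this
      simp only
      rw [← sq_abs]
      exact pow_le_pow_left₀ (abs_nonneg _) this 2
    rw [← hσ] at a1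
    have a3 := a1.trans (mul_le_mul_of_nonneg_left a2 hσ0.le)
    have t0 : 0 ≤ t ^ (d - 1) := pow_nonneg ht.le _
    have tr : t ^ (d - 1) ≤ r ^ (d - 1) := pow_le_pow_left₀ ht.le htr.le _
    calc F t ^ 2 ≤ (t ^ (d - 1)) ^ 2 * (σ * ∫ z : sphere (0 : EuclideanSpace ℝ (Fin d)) 1,
          ‖fderiv ℝ w (y + t • (z : EuclideanSpace ℝ (Fin d)))‖ ^ 2 ∂μ) := by
          simp only [hF, mul_pow]
          exact mul_le_mul_of_nonneg_left a3 (sq_nonneg _)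
      _ = σ * t ^ (d - 1) * Q t := by simp only [hQ]; ring
      _ ≤ σ * r ^ (d - 1) * P t := by
          have q0 := Q0 t ht.le
          have : Q t ≤ P t := by
            have : 0 ≤ lam * σ * t ^ (d - 1) := by positivity
            simp only [hP]; linarith
          gcongr
  · intro s hs t ht hst
    have := hincr s t hs.1.le hst
    have : 0 ≤ lam * σ / d * (t - s) ^ d := by
      have := sub_nonneg.2 hst
      positivity
    linarith
  · intro s t hs hst htr
    refine (hMl.trans ?_).trans (hincr s t hs.le (by linarith))
    have : δ ≤ t - s := by linarith
    gcongr

lemma exists_global {d : ℕ} {v : EuclideanSpace ℝ (Fin d) → ℝ} {y : EuclideanSpace ℝ (Fin d)}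
    {r r' : ℝ} (hr' : 0 < r') (hrr : r' < r) (hv : ContDiffOn ℝ 2 v (ball y r)) :
    ∃ w : EuclideanSpace ℝ (Fin d) → ℝ, ContDiff ℝ 2 w ∧ ∀ x ∈ ball y r', w x = v x := by
  let b : ContDiffBump y := ⟨r', (r' + r) / 2, hr', by linarith⟩
  refine ⟨fun x => b x * v x, ?_, ?_⟩
  · rw [contDiff_iff_contDiffAt]
    intro x
    by_cases hx : x ∈ ball y r
    · exact b.contDiffAt.mul (hv.contDiffAt (isOpen_ball.mem_nhds hx))
    · have hx2 : x ∈ (closedBall y ((r' + r) / 2))ᶜ := by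
        simp only [mem_ball, not_lt, Set.mem_compl_iff, mem_closedBall, not_le] at hx ⊢
        linarith
      refine (contDiffAt_const (c := (0:ℝ))).congr_of_eventuallyEq ?_
      filter_upwards [isClosed_closedBall.isOpen_compl.mem_nhds hx2] with z hz
      have : b z = 0 := b.zero_of_le_dist (by
        simp only [Set.mem_compl_iff, mem_closedBall, not_le] at hz
        exact hz.le)
      simp [this]
  · intro x hx
    have : b x = 1 := b.one_of_mem_closedBall (ball_subset_closedBall hx)
    simp [this]

theorem statement1 (d : ℕ) (hd : 3 ≤ d) (V : EuclideanSpace ℝ (Fin d) → ℝ)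
    (hV : Continuous V) (r R : ℝ) (hr : 0 < r) (hR : 0 < R)
    (lam : EuclideanSpace ℝ (Fin d) → ℝ)
    (hlam : ∀ M : ℝ, ∃ R₁ : ℝ, ∀ y : EuclideanSpace ℝ (Fin d), R₁ ≤ ‖y‖ → M ≤ lam y)
    (hRicc : ∀ y : EuclideanSpace ℝ (Fin d), R ≤ ‖y‖ →
      ∃ v : EuclideanSpace ℝ (Fin d) → ℝ, ContDiffOn ℝ 2 v (ball y r) ∧
        ∀ x ∈ ball y r, -laplacian v x + ‖gradient v x‖ ^ 2 + lam y = V x) :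
    ∀ A > (0:ℝ), ∀ ε > (0:ℝ), ∃ R' > (0:ℝ), ∀ y : EuclideanSpace ℝ (Fin d), R' ≤ ‖y‖ →
      volume {p : ℝ × ℝ | 0 < p.1 ∧ p.1 < p.2 ∧ p.2 < r ∧
        (∫ x in ball y p.2 \ closure (ball y p.1), V x) ≤ A} ≤ ENNReal.ofReal ε := by
  intro A hA ε hε
  have : Nonempty (Fin d) := ⟨⟨0, by omega⟩⟩
  have hd0 : (0:ℝ) < d := by exact_mod_cast (by omega : 0 < d)
  obtain ⟨σ, hσ⟩ : ∃ σ, σ = (volume : Measure (EuclideanSpace ℝ (Fin d))).toSphere.real Set.univ :=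
    ⟨_, rfl⟩
  have hσ0 : 0 < σ := by
    rw [hσ, measureReal_def]
    refine ENNReal.toReal_pos ?_ (measure_ne_top _ _)
    exact fun h => Measure.toSphere_ne_zero _ (Measure.measure_univ_eq_zero.1 h)
  set δ := ε / (4 * r) with hδ
  have hδ0 : 0 < δ := by positivity
  set η := min (r / 2) δ with hη
  have hη0 : 0 < η := by positivity
  have hηr : η ≤ r / 2 := min_le_left _ _
  have hηδ : η ≤ δ := min_le_right _ _
  set C := σ * r ^ (d - 1) with hC
  have hC0 : 0 < C := by positivity
  set M := max (2 * A) (128 * r * C / ε) with hM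
  have hM0 : 0 < M := lt_max_of_lt_left (by positivity)
  obtain ⟨R₁, hR₁⟩ := hlam (M * d / (σ * δ ^ d))
  refine ⟨max R R₁, lt_max_of_lt_left hR, fun y hy => ?_⟩
  have hly := hR₁ y ((le_max_right _ _).trans hy)
  have hl0 : 0 < lam y := lt_of_lt_of_le (by positivity) hly
  obtain ⟨v, hv, hvR⟩ := hRicc y ((le_max_left _ _).trans hy)
  have hr1 : 0 < r - η := by linarith
  obtain ⟨w, hw, hwv⟩ := exists_global hr1 (by linarith : r - η < r) hv
  have hwR : ∀ x ∈ ball y (r - η), -laplacian w x + ‖gradient w x‖ ^ 2 + lam y = V x := by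
    intro x hx
    have hev : w =ᶠ[nhds x] v := by
      filter_upwards [isOpen_ball.mem_nhds hx] with z hz using hwv z hz
    have e1 : gradient w x = gradient v x := by simp only [gradient, hev.fderiv_eq]
    have e2 : laplacian w x = laplacian v x := by
      simp only [laplacian, (hev.fderiv (𝕜 := ℝ)).fderiv_eq]
    rw [e1, e2]
    exact hvR x (ball_subset_ball (by linarith) hx)
  have hMl : M ≤ lam y * σ / d * δ ^ d := by
    rw [div_le_iff₀ (by positivity)] at hly
    rw [div_mul_eq_mul_div, le_div_iff₀ hd0]
    linarith
  have hest := global_est hd hV hw y hr1 hl0 hδ0 hM0 (le_max_left _ _) hσ hσ0 hMl hwR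
  have hsub : {p : ℝ × ℝ | 0 < p.1 ∧ p.1 < p.2 ∧ p.2 < r ∧
        (∫ x in ball y p.2 \ closure (ball y p.1), V x) ≤ A} ⊆
      {p : ℝ × ℝ | 0 < p.1 ∧ p.1 < p.2 ∧ p.2 < r - η ∧
        (∫ x in ball y p.2 \ closure (ball y p.1), V x) ≤ A} ∪
      Set.Ioo 0 r ×ˢ Set.Ico (r - η) r := by
    rintro ⟨s, t⟩ ⟨h1, h2, h3, h4⟩
    by_cases ht : t < r - η
    · exact Or.inl ⟨h1, h2, ht, h4⟩
    · exact Or.inr ⟨⟨h1, h2.trans h3⟩, ⟨not_lt.1 ht, h3⟩⟩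
  have hstrip : volume (Set.Ioo 0 r ×ˢ Set.Ico (r - η) r) = ENNReal.ofReal (r * η) := by
    rw [Measure.volume_eq_prod, Measure.prod_prod, Real.volume_Ioo, Real.volume_Ico,
      ENNReal.ofReal_mul hr.le]
    simp
  refine (measure_mono hsub).trans ((measure_union_le _ _).trans ?_)
  rw [hstrip]
  refine (add_le_add_left hest _).trans ?_
  rw [← ENNReal.ofReal_add (by positivity) (by positivity)]
  apply ENNReal.ofReal_le_ofReal
  have b1 : r * δ = ε / 4 := by rw [hδ]; field_simp
  have b2 : r * (32 * C / M) ≤ ε / 4 := by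
    have : 128 * r * C / ε ≤ M := le_max_right _ _
    rw [div_le_iff₀ hε] at this
    rw [mul_div_assoc', div_le_iff₀ hM0]
    linarith
  have b3 : (r - η) * δ ≤ r * δ := by gcongr; linarith
  have b4 : (r - η) * (32 * (σ * (r - η) ^ (d - 1)) / M) ≤ r * (32 * C / M) := by
    rw [hC]
    have : r - η ≤ r := by linarith
    gcongr
  have b5 : r * η ≤ r * δ := by gcongr
  linarith
end
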